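/- Let P be a homogeneous Poisson point process in R^d with intensity ν > 0, let Ω ⊂ R^d be compact, and fix 1 ≤ i ≤ d and j ≥ 0. Let F_{i,j} be the number of subsets X ⊂ P with |X| = i+1 such that the center c(X) of the minimal circumscribed sphere of X lies in Ω ∩ σ(X) and exactly j points of P lie in the open circumscribed ball of X. Then E[F_{i,j}] = D · ν for a constant D depending only on d, i, j, and Ω (in particular, the expectation is linear in the intensity ν). -/

import Mathlib

open Metric MeasureTheory ProbabilityTheory
open scoped NNReal ENNReal
noncomputable section

variable {d : ℕ}

/-- A homogeneous Poisson point process on `ℝ^d` with intensity `ν`: a random locally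
finite point set whose counts in finite-volume Borel sets are Poisson with mean
`ν · Leb(A)`, with independent counts on disjoint Borel sets. -/
structure IsHomPoissonPP {Ωs : Type} [MeasurableSpace Ωs] (μ : Measure Ωs)
    (X : Ωs → Set (EuclideanSpace ℝ (Fin d))) (ν : ℝ≥0) : Prop where
  prob : IsProbabilityMeasure μ
  locallyFinite : ∀ ω, ∀ A : Set (EuclideanSpace ℝ (Fin d)),
    Bornology.IsBounded A → (X ω ∩ A).Finite
  counts_measurable : ∀ A : Set (EuclideanSpace ℝ (Fin d)), MeasurableSet A →
    Measurable fun ω => (X ω ∩ A).ncard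
  poisson_counts : ∀ A : Set (EuclideanSpace ℝ (Fin d)), MeasurableSet A →
    volume A ≠ ⊤ →
    Measure.map (fun ω => (X ω ∩ A).ncard) μ = poissonMeasure (ν * (volume A).toNNReal)
  indep_counts : ∀ A B : Set (EuclideanSpace ℝ (Fin d)), MeasurableSet A →
    MeasurableSet B → Disjoint A B →
    IndepFun (fun ω => (X ω ∩ A).ncard) (fun ω => (X ω ∩ B).ncard) μ

/-- `c` is the center (with radius `ρ`) of the minimal circumscribed ball of `Y`. -/
def IsMinBall (Y : Set (EuclideanSpace ℝ (Fin d))) (c : EuclideanSpace ℝ (Fin d))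
    (ρ : ℝ) : Prop :=
  Y ⊆ closedBall c ρ ∧ ∀ c' ρ', Y ⊆ closedBall c' ρ' → ρ ≤ ρ'

/-- `c` lies in the open simplex spanned by `Y` (strictly positive convex combination). -/
def MemOpenSimplex (Y : Finset (EuclideanSpace ℝ (Fin d)))
    (c : EuclideanSpace ℝ (Fin d)) : Prop :=
  ∃ w : EuclideanSpace ℝ (Fin d) → ℝ,
    (∀ q ∈ Y, 0 < w q) ∧ ∑ q ∈ Y, w q = 1 ∧ ∑ q ∈ Y, w q • q = c

/-- The number of `(i+1)`-point critical configurations `Y ⊆ S` whose minimal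
circumscribed sphere has center in `Ω ∩ σ(Y)` and whose open circumscribed ball contains
exactly `j` points of `S`. -/
def critConfigCount (i j : ℕ) (Ω : Set (EuclideanSpace ℝ (Fin d)))
    (S : Set (EuclideanSpace ℝ (Fin d))) : ℕ :=
  Set.ncard {Y : Finset (EuclideanSpace ℝ (Fin d)) | ↑Y ⊆ S ∧ Y.card = i + 1 ∧
    ∃ c ρ, IsMinBall (↑Y) c ρ ∧ c ∈ Ω ∧ MemOpenSimplex Y c ∧
      (S ∩ ball c ρ).ncard = j}

/-- Locally finite subsets of `E`. -/
def LocFin (E : Type*) [Bornology E] : Type _ :=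
  {S : Set E // ∀ A : Set E, Bornology.IsBounded A → (S ∩ A).Finite}

/-- The events that a locally finite set misses a given bounded measurable set. -/
def voidEvents (E : Type*) [Bornology E] [MeasurableSpace E] : Set (Set (LocFin E)) :=
  {T | ∃ A : Set E, MeasurableSet A ∧ Bornology.IsBounded A ∧ T = {S | S.1 ∩ A = ∅}}

instance (E : Type*) [Bornology E] [MeasurableSpace E] : MeasurableSpace (LocFin E) :=
  MeasurableSpace.generateFrom (voidEvents E)

section Enumeration

variable {E : Type*} [NormedAddCommGroup E] [MeasurableSpace E]

/-- A measurable injection whose sublevel sets are bounded: it enumerates every locally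
finite set in increasing order. -/
lemma exists_measurable_injective_bounded_sublevel [CompleteSpace E]
    [SecondCountableTopology E] [BorelSpace E] :
    ∃ f : E → ℝ, Measurable f ∧ Function.Injective f ∧
      ∀ q, Bornology.IsBounded {x | f x < q} := by
  obtain ⟨g, hg⟩ := exists_measurableEmbedding_real E
  refine ⟨fun x => (⌊‖x‖⌋₊ : ℝ) + Real.sigmoid (g x), ?_, ?_, ?_⟩
  · have h1 : Measurable fun x : E => (⌊‖x‖⌋₊ : ℝ) :=
      measurable_from_nat.comp (Nat.measurable_floor.comp measurable_norm)
    exact h1.add (continuous_sigmoid.measurable.comp hg.measurable)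
  · intro x y hxy
    have hx := Real.sigmoid_pos (g x)
    have hx' := Real.sigmoid_lt_one (g x)
    have hy := Real.sigmoid_pos (g y)
    have hy' := Real.sigmoid_lt_one (g y)
    simp only at hxy
    have h1 : (⌊‖x‖⌋₊ : ℝ) < (⌊‖y‖⌋₊ : ℝ) + 1 := by linarith
    have h2 : (⌊‖y‖⌋₊ : ℝ) < (⌊‖x‖⌋₊ : ℝ) + 1 := by linarith
    have h3 : ⌊‖x‖⌋₊ = ⌊‖y‖⌋₊ := by
      have h1' : ⌊‖x‖⌋₊ < ⌊‖y‖⌋₊ + 1 := by exact_mod_cast h1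
      have h2' : ⌊‖y‖⌋₊ < ⌊‖x‖⌋₊ + 1 := by exact_mod_cast h2
      omega
    rw [h3] at hxy
    exact hg.injective (Real.sigmoid_strictMono.injective (add_left_cancel hxy))
  · intro q
    refine (isBounded_ball (x := (0 : E)) (r := q + 1)).subset fun x hx => ?_
    have hx' := Real.sigmoid_pos (g x)
    have := Nat.lt_floor_add_one ‖x‖
    simp only [Set.mem_ofPred_eq] at hx
    rw [mem_ball_zero_iff]
    linarith

lemma measurableSet_hit {A : Set E} (hA : MeasurableSet A) (hb : Bornology.IsBounded A) :
    MeasurableSet {S : LocFin E | (S.1 ∩ A).Nonempty} := by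
  have : MeasurableSet {S : LocFin E | S.1 ∩ A = ∅} :=
    MeasurableSpace.measurableSet_generateFrom ⟨A, hA, hb, rfl⟩
  convert! this.compl using 1
  ext S
  simp [Set.nonempty_iff_ne_empty]

variable {f : E → ℝ} (hf : Measurable f) (hinj : Function.Injective f)
  (hbd : ∀ q, Bornology.IsBounded {x | f x < q})

include hf hinj in
lemma measurableSet_le_ncard (k : ℕ) {A : Set E} (hA : MeasurableSet A)
    (hb : Bornology.IsBounded A) : MeasurableSet {S : LocFin E | k ≤ (S.1 ∩ A).ncard} := by
  induction k generalizing A with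
  | zero => simp
  | succ k ih =>
    have key : {S : LocFin E | k + 1 ≤ (S.1 ∩ A).ncard} =
        ⋃ q : ℚ, {S : LocFin E | k ≤ (S.1 ∩ (A ∩ {x | f x < q})).ncard} ∩
          {S : LocFin E | (S.1 ∩ (A ∩ {x | q ≤ f x})).Nonempty} := by
      ext S
      simp only [Set.mem_ofPred_eq, Set.mem_iUnion, Set.mem_inter_iff]
      have hfin : (S.1 ∩ A).Finite := S.2 A hb
      constructor
      · intro h
        have hne : (S.1 ∩ A).Nonempty := by
          rw [← Set.ncard_pos hfin]; omega
        obtain ⟨x, hx, hmax⟩ := Set.exists_max_image _ f hfin hne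
        have hfin' : ((S.1 ∩ A) \ {x}).Finite := hfin.sdiff
        obtain ⟨q, hq, hq'⟩ : ∃ q : ℚ, (∀ y ∈ (S.1 ∩ A) \ {x}, f y < q) ∧ (q : ℝ) < f x := by
          rcases ((S.1 ∩ A) \ {x}).eq_empty_or_nonempty with h0 | h0
          · obtain ⟨q, hq⟩ := exists_rat_lt (f x)
            exact ⟨q, by simp [h0], hq⟩
          · obtain ⟨z, hz, hzmax⟩ := Set.exists_max_image _ f hfin' h0
            have hzx : f z < f x :=
              lt_of_le_of_ne (hmax z hz.1) fun h => hz.2 (hinj h)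
            obtain ⟨q, h1, h2⟩ := exists_rat_btwn hzx
            exact ⟨q, fun y hy => (hzmax y hy).trans_lt h1, h2⟩
        refine ⟨q, ?_, x, hx.1, hx.2, hq'.le⟩
        have h1 : ((S.1 ∩ A) \ {x}).ncard + 1 = (S.1 ∩ A).ncard :=
          Set.ncard_sdiff_singleton_add_one hx hfin
        have h2 : ((S.1 ∩ A) \ {x}).ncard ≤ (S.1 ∩ (A ∩ {x | f x < q})).ncard :=
          Set.ncard_le_ncard (fun y hy => ⟨hy.1.1, hy.1.2, hq y hy⟩)
            (hfin.subset fun y hy => ⟨hy.1, hy.2.1⟩)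
        omega
      · rintro ⟨q, h1, x, hxS, hxA, hxq⟩
        have h2 : insert x (S.1 ∩ (A ∩ {x | f x < q})) ⊆ S.1 ∩ A := by
          rintro y (rfl | hy)
          · exact ⟨hxS, hxA⟩
          · exact ⟨hy.1, hy.2.1⟩
        have h3 := Set.ncard_le_ncard h2 hfin
        rw [Set.ncard_insert_of_notMem (fun h => absurd (h.2.2 : f x < q) (not_lt.2 hxq))
          (hfin.subset fun y hy => ⟨hy.1, hy.2.1⟩)] at h3
        omega
    rw [key]
    refine MeasurableSet.iUnion fun q => ?_
    refine (ih (hA.inter (measurableSet_lt hf measurable_const))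
      (hb.subset Set.inter_subset_left)).inter ?_
    exact measurableSet_hit (hA.inter (measurableSet_le measurable_const hf))
      (hb.subset Set.inter_subset_left)

include hf hinj in
lemma measurableSet_ncard_eq (k : ℕ) {A : Set E} (hA : MeasurableSet A)
    (hb : Bornology.IsBounded A) : MeasurableSet {S : LocFin E | (S.1 ∩ A).ncard = k} := by
  convert! (measurableSet_le_ncard hf hinj k hA hb).diff
    (measurableSet_le_ncard hf hinj (k + 1) hA hb) using 1
  ext S
  simp only [Set.mem_ofPred_eq, Set.mem_sdiff]
  omega

/-- The number of points of `S` preceding `x` in the order induced by `f`. -/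
def rankIn (f : E → ℝ) (S : LocFin E) (x : E) : ℕ := (S.1 ∩ {y | f y < f x}).ncard

omit [MeasurableSpace E] in
include hbd hinj in
lemma rankIn_injOn (S : LocFin E) : Set.InjOn (rankIn f S) S.1 := by
  have key : ∀ x ∈ S.1, ∀ y ∈ S.1, f x < f y → rankIn f S x < rankIn f S y := by
    intro x hx y hy h
    refine Set.ncard_lt_ncard ⟨fun z hz => ⟨hz.1, lt_trans hz.2 h⟩, fun h' => ?_⟩
      (S.2 _ (hbd _))
    exact lt_irrefl (f x) (h' ⟨hx, h⟩ : x ∈ S.1 ∩ {y | f y < f x}).2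
  intro x hx y hy h
  by_contra hne
  rcases lt_or_gt_of_ne (fun h => hne (hinj h) : f x ≠ f y) with h1 | h1
  · exact (key x hx y hy h1).ne h
  · exact (key y hy x hx h1).ne h.symm

include hf hinj hbd in
lemma measurableSet_exists_rankIn (k : ℕ) {A : Set E} (hA : MeasurableSet A) :
    MeasurableSet {S : LocFin E | ∃ x ∈ S.1, x ∈ A ∧ rankIn f S x = k} := by
  have hlt : ∀ q : ℚ, MeasurableSet {x | f x < q} := fun q =>
    measurableSet_lt hf measurable_const
  have key : {S : LocFin E | ∃ x ∈ S.1, x ∈ A ∧ rankIn f S x = k} =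
      ⋃ (q : ℚ) (r : ℚ), {S : LocFin E | (S.1 ∩ {x | f x < q}).ncard = k} ∩
        ({S : LocFin E | (S.1 ∩ {x | f x < r}).ncard = k + 1} ∩
        {S : LocFin E | (S.1 ∩ (A ∩ ({x | q ≤ f x} ∩ {x | f x < r}))).Nonempty}) := by
    ext S
    simp only [Set.mem_ofPred_eq, Set.mem_iUnion, Set.mem_inter_iff]
    constructor
    · rintro ⟨x, hxS, hxA, hk⟩
      have hfin : (S.1 ∩ {y | f y < f x}).Finite := S.2 _ (hbd _)
      have hfin2 : (S.1 ∩ {y | f x < f y ∧ f y < f x + 1}).Finite :=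
        S.2 _ ((hbd (f x + 1)).subset fun y hy => hy.2)
      obtain ⟨q, hq, hq'⟩ : ∃ q : ℚ, (∀ y ∈ S.1 ∩ {y | f y < f x}, f y < q) ∧
          (q : ℝ) < f x := by
        rcases (S.1 ∩ {y | f y < f x}).eq_empty_or_nonempty with h0 | h0
        · obtain ⟨q, hq⟩ := exists_rat_lt (f x)
          exact ⟨q, by simp [h0], hq⟩
        · obtain ⟨z, hz, hzmax⟩ := Set.exists_max_image _ f hfin h0
          obtain ⟨q, h1, h2⟩ := exists_rat_btwn (show f z < f x from hz.2)
          exact ⟨q, fun y hy => (hzmax y hy).trans_lt h1, h2⟩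
      obtain ⟨r, hr, hr'⟩ : ∃ r : ℚ, (∀ y ∈ S.1, f x < f y → (r : ℝ) ≤ f y) ∧
          f x < r := by
        rcases (S.1 ∩ {y | f x < f y ∧ f y < f x + 1}).eq_empty_or_nonempty with h0 | h0
        · obtain ⟨r, h1, h2⟩ := exists_rat_btwn (lt_add_one (f x))
          refine ⟨r, fun y hy hxy => ?_, h1⟩
          by_contra! h
          exact (Set.eq_empty_iff_forall_notMem.1 h0) y ⟨hy, hxy, h.trans h2⟩
        · obtain ⟨z, hz, hzmin⟩ := Set.exists_min_image _ f hfin2 h0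
          obtain ⟨r, h1, h2⟩ := exists_rat_btwn hz.2.1
          refine ⟨r, fun y hy hxy => ?_, h1⟩
          by_contra! h
          have := hzmin y ⟨hy, hxy, h.trans (h2.trans hz.2.2)⟩
          linarith
      refine ⟨q, r, ?_, ?_, x, hxS, hxA, hq'.le, hr'⟩
      · rw [← hk, rankIn]
        congr 1
        ext y
        exact ⟨fun h => ⟨h.1, lt_trans h.2 hq'⟩, fun h => ⟨h.1, hq y h⟩⟩
      · rw [← hk, rankIn, ← Set.ncard_insert_of_notMem (a := x) _ hfin]
        · congr 1
          ext y
          constructor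
          · rintro ⟨hy, hyr⟩
            rcases lt_trichotomy (f y) (f x) with h | h | h
            · exact Or.inr ⟨hy, h⟩
            · exact Or.inl (hinj h)
            · exact absurd hyr (not_lt.2 (hr y hy h))
          · rintro (rfl | hy)
            · exact ⟨hxS, hr'⟩
            · exact ⟨hy.1, lt_trans hy.2 hr'⟩
        · exact fun h => lt_irrefl (f x) h.2
    · rintro ⟨q, r, hq, hr, x, hxS, hxA, hqx, hxr⟩
      refine ⟨x, hxS, hxA, le_antisymm ?_ ?_⟩
      · have h1 : insert x (S.1 ∩ {y | f y < f x}) ⊆ S.1 ∩ {x | f x < r} := by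
          rintro y (rfl | hy)
          · exact ⟨hxS, hxr⟩
          · exact ⟨hy.1, (lt_trans hy.2 hxr : f y < r)⟩
        have h2 := Set.ncard_le_ncard h1 (S.2 _ (hbd _))
        rw [Set.ncard_insert_of_notMem (fun h => lt_irrefl (f x) h.2) (S.2 _ (hbd _)), hr] at h2
        exact Nat.le_of_succ_le_succ h2
      · rw [← hq]
        exact Set.ncard_le_ncard (fun y hy => ⟨hy.1, (lt_of_lt_of_le hy.2 hqx : f y < f x)⟩)
          (S.2 _ (hbd _))
  rw [key]
  refine MeasurableSet.iUnion fun q => MeasurableSet.iUnion fun r => ?_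
  refine (measurableSet_ncard_eq hf hinj _ (hlt q) (hbd _)).inter
    ((measurableSet_ncard_eq hf hinj _ (hlt r) (hbd _)).inter ?_)
  exact measurableSet_hit (hA.inter ((measurableSet_le measurable_const hf).inter (hlt r)))
    ((hbd r).subset fun x hx => hx.2.2)

open Classical in
/-- The point of rank `k` of `S`, or `0` if there is none. -/
def pointOfRank (f : E → ℝ) (k : ℕ) (S : LocFin E) : E :=
  if h : ∃ x ∈ S.1, rankIn f S x = k then h.choose else 0

/-- The event that a locally finite set has a point of rank `k`. -/
def hasRank (f : E → ℝ) (k : ℕ) : Set (LocFin E) := {S | ∃ x ∈ S.1, rankIn f S x = k}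

omit [MeasurableSpace E] in
lemma pointOfRank_spec {k : ℕ} {S : LocFin E} (h : S ∈ hasRank f k) :
    pointOfRank f k S ∈ S.1 ∧ rankIn f S (pointOfRank f k S) = k := by
  have h' : ∃ x ∈ S.1, rankIn f S x = k := h
  rw [pointOfRank, dif_pos h']
  exact h'.choose_spec

omit [MeasurableSpace E] in
include hinj hbd in
lemma pointOfRank_rankIn {S : LocFin E} {x : E} (hx : x ∈ S.1) :
    pointOfRank f (rankIn f S x) S = x := by
  have h := pointOfRank_spec (f := f) (S := S) (k := rankIn f S x) ⟨x, hx, rfl⟩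
  exact rankIn_injOn hinj hbd S h.1 hx h.2

include hf hinj hbd in
lemma measurableSet_hasRank (k : ℕ) : MeasurableSet (hasRank f k) := by
  simpa [hasRank] using measurableSet_exists_rankIn hf hinj hbd k MeasurableSet.univ

include hf hinj hbd in
lemma measurable_pointOfRank (k : ℕ) : Measurable (pointOfRank f k) := by
  intro A hA
  have key : pointOfRank f k ⁻¹' A =
      {S : LocFin E | ∃ x ∈ S.1, x ∈ A ∧ rankIn f S x = k} ∪
        ((hasRank f k)ᶜ ∩ {_S | (0 : E) ∈ A}) := by
    ext S
    by_cases h : S ∈ hasRank f k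
    · have hs := pointOfRank_spec h
      simp only [Set.mem_preimage, Set.mem_union, Set.mem_ofPred_eq, Set.mem_inter_iff,
        Set.mem_compl_iff, h, not_true_eq_false, false_and, or_false]
      refine ⟨fun h' => ⟨_, hs.1, h', hs.2⟩, ?_⟩
      rintro ⟨x, hx, hxA, rfl⟩
      rwa [pointOfRank_rankIn hinj hbd hx]
    · have h0 : pointOfRank f k S = 0 := dif_neg h
      simp only [Set.mem_preimage, h0, Set.mem_union, Set.mem_ofPred_eq, Set.mem_inter_iff,
        Set.mem_compl_iff, h, not_false_eq_true, true_and]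
      refine ⟨Or.inr, ?_⟩
      rintro (⟨x, hx, _, hk⟩ | h')
      · exact absurd ⟨x, hx, hk⟩ h
      · exact h'
  rw [key]
  exact (measurableSet_exists_rankIn hf hinj hbd k hA).union
    ((measurableSet_hasRank hf hinj hbd k).compl.inter (MeasurableSet.const _))

end Enumeration

section MinimalBall

variable {ι : Type*} [Fintype ι]

/-- The radius of the smallest ball containing a finite family of points. -/
def minRadius (y : ι → EuclideanSpace ℝ (Fin d)) : ℝ :=
  infDist y (Set.range (Function.const ι))

lemma exists_minCenter [Nonempty ι] (y : ι → EuclideanSpace ℝ (Fin d)) :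
    ∃ c : EuclideanSpace ℝ (Fin d), minRadius y = dist y (Function.const ι c) := by
  have hclosed : IsClosed (Set.range (Function.const ι : EuclideanSpace ℝ (Fin d) → _)) := by
    have h : Isometry (Function.const ι : EuclideanSpace ℝ (Fin d) → _) :=
      Isometry.of_dist_eq fun a b => dist_pi_const a b
    exact h.isClosedEmbedding.isClosed_range
  obtain ⟨_, ⟨c, rfl⟩, hc⟩ := hclosed.exists_infDist_eq_dist (Set.range_nonempty _) y
  exact ⟨c, hc⟩

/-- The center of the smallest ball containing a finite family of points. -/
def minCenter [Nonempty ι] (y : ι → EuclideanSpace ℝ (Fin d)) : EuclideanSpace ℝ (Fin d) :=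
  (exists_minCenter y).choose

lemma minRadius_eq [Nonempty ι] (y : ι → EuclideanSpace ℝ (Fin d)) :
    minRadius y = dist y (Function.const ι (minCenter y)) :=
  (exists_minCenter y).choose_spec

lemma minRadius_le (y : ι → EuclideanSpace ℝ (Fin d)) (p : EuclideanSpace ℝ (Fin d)) :
    minRadius y ≤ dist y (Function.const ι p) :=
  infDist_le_dist_of_mem ⟨p, rfl⟩

lemma minRadius_nonneg (y : ι → EuclideanSpace ℝ (Fin d)) : 0 ≤ minRadius y :=
  infDist_nonneg

lemma continuous_minRadius :
    Continuous (minRadius : (ι → EuclideanSpace ℝ (Fin d)) → ℝ) :=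
  continuous_infDist_pt _

lemma dist_minCenter_sq_le [Nonempty ι] (y : ι → EuclideanSpace ℝ (Fin d))
    (p : EuclideanSpace ℝ (Fin d)) :
    dist (minCenter y) p ^ 2 ≤
      2 * (dist y (Function.const ι p) ^ 2 - minRadius y ^ 2) := by
  set c := minCenter y with hc
  set r := minRadius y with hr
  set R := dist y (Function.const ι p) with hR
  set q : EuclideanSpace ℝ (Fin d) := (2⁻¹ : ℝ) • (c + p) with hq
  have hr0 : 0 ≤ r := minRadius_nonneg y
  have key : ∀ k, dist (y k) q ^ 2 ≤ (r ^ 2 + R ^ 2) / 2 - dist c p ^ 2 / 4 := by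
    intro k
    have h1 : dist (y k) c ≤ r := by
      rw [hr, minRadius_eq]
      exact dist_le_pi_dist y (Function.const ι c) k
    have h2 : dist (y k) p ≤ R := dist_le_pi_dist y (Function.const ι p) k
    have h1' : dist (y k) c ^ 2 ≤ r ^ 2 := by gcongr
    have h2' : dist (y k) p ^ 2 ≤ R ^ 2 := by gcongr
    have par := parallelogram_law_with_norm ℝ (y k - c) (y k - p)
    have e1 : (y k - c) + (y k - p) = (2 : ℝ) • (y k - q) := by
      rw [hq]; module
    have e2 : (y k - c) - (y k - p) = -(c - p) := by abel
    rw [e1, e2, norm_smul, norm_neg, ← dist_eq_norm, ← dist_eq_norm, ← dist_eq_norm,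
      ← dist_eq_norm] at par
    simp only [Real.norm_ofNat] at par
    nlinarith
  have hle : r ≤ √((r ^ 2 + R ^ 2) / 2 - dist c p ^ 2 / 4) := by
    refine (minRadius_le y q).trans ?_
    rw [dist_pi_le_iff (Real.sqrt_nonneg _)]
    exact fun k => Real.le_sqrt_of_sq_le (key k)
  obtain ⟨k⟩ := ‹Nonempty ι›
  have h0 : 0 ≤ (r ^ 2 + R ^ 2) / 2 - dist c p ^ 2 / 4 := (sq_nonneg _).trans (key k)
  have := (Real.le_sqrt hr0 h0).1 hle
  linarith

lemma continuous_minCenter [Nonempty ι] :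
    Continuous (minCenter : (ι → EuclideanSpace ℝ (Fin d)) → _) := by
  rw [continuous_iff_continuousAt]
  intro y
  rw [ContinuousAt, tendsto_iff_dist_tendsto_zero]
  have h1 : ∀ z : ι → EuclideanSpace ℝ (Fin d), dist (minCenter z) (minCenter y) ≤
      √(2 * ((dist z y + minRadius y) ^ 2 - minRadius z ^ 2)) := by
    intro z
    refine Real.le_sqrt_of_sq_le ((dist_minCenter_sq_le z (minCenter y)).trans ?_)
    have : dist z (Function.const ι (minCenter y)) ≤ dist z y + minRadius y := by
      rw [minRadius_eq y]; exact dist_triangle _ _ _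
    gcongr
  refine squeeze_zero (fun _ => dist_nonneg) h1 ?_
  have h2 : Continuous fun z : ι → EuclideanSpace ℝ (Fin d) =>
      √(2 * ((dist z y + minRadius y) ^ 2 - minRadius z ^ 2)) := by
    have := continuous_minRadius (ι := ι) (d := d)
    fun_prop
  have h3 := h2.tendsto y
  simpa using h3

lemma isMinBall_range_iff [Nonempty ι] (y : ι → EuclideanSpace ℝ (Fin d))
    (c : EuclideanSpace ℝ (Fin d)) (ρ : ℝ) :
    IsMinBall (Set.range y) c ρ ↔ c = minCenter y ∧ ρ = minRadius y := by
  have hsub : ∀ (c : EuclideanSpace ℝ (Fin d)) (ρ : ℝ), Set.range y ⊆ closedBall c ρ ↔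
      dist y (Function.const ι c) ≤ ρ := by
    intro c ρ
    rw [dist_pi_le_iff', Set.range_subset_iff]
    · rfl
  unfold IsMinBall
  simp only [hsub]
  constructor
  · rintro ⟨h1, h2⟩
    have h3 : ρ = minRadius y :=
      le_antisymm (h2 _ _ (minRadius_eq y).ge) ((minRadius_le y c).trans h1)
    refine ⟨?_, h3⟩
    have h4 := dist_minCenter_sq_le y c
    have h5 : dist y (Function.const ι c) = minRadius y :=
      le_antisymm (h3 ▸ h1) (minRadius_le y c)
    rw [h5, sub_self, mul_zero] at h4
    have h6 : dist (minCenter y) c = 0 := by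
      have := dist_nonneg (x := minCenter y) (y := c)
      nlinarith
    exact (dist_eq_zero.1 h6).symm
  · rintro ⟨rfl, rfl⟩
    exact ⟨(minRadius_eq y).ge, fun c' ρ' h => (minRadius_le y c').trans h⟩

/-- The family has the center of its smallest ball as a convex combination with positive
weights. -/
def CenterInSimplex [Nonempty ι] (y : ι → EuclideanSpace ℝ (Fin d)) : Prop :=
  ∃ w : ι → ℝ, (∀ k, 0 < w k) ∧ ∑ k, w k = 1 ∧ ∑ k, w k • y k = minCenter y

lemma measurableSet_centerInSimplex [Nonempty ι] :
    MeasurableSet {y : ι → EuclideanSpace ℝ (Fin d) | CenterInSimplex y} := by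
  let K : ℕ → Set (ι → ℝ) := fun n =>
    (Set.univ.pi fun _ => Set.Icc (1 / ((n : ℝ) + 1)) 1) ∩ {w | ∑ k, w k = 1}
  have hK : ∀ n, IsCompact (K n) := fun n =>
    (isCompact_univ_pi fun _ => isCompact_Icc).inter_right
      (isClosed_eq (by fun_prop) continuous_const)
  have key : {y : ι → EuclideanSpace ℝ (Fin d) | CenterInSimplex y} =
      ⋃ n, {y | ∃ w ∈ K n, ∑ k, w k • y k = minCenter y} := by
    ext y
    simp only [Set.mem_ofPred_eq, Set.mem_iUnion, CenterInSimplex]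
    constructor
    · rintro ⟨w, hw, h1, h2⟩
      obtain ⟨k0, -, hk0⟩ := Finset.exists_min_image Finset.univ w Finset.univ_nonempty
      obtain ⟨n, hn⟩ := exists_nat_one_div_lt (hw k0)
      refine ⟨n, w, ⟨fun k _ => ⟨hn.le.trans (hk0 k (Finset.mem_univ _)), ?_⟩, h1⟩, h2⟩
      rw [← h1]
      exact Finset.single_le_sum (fun j _ => (hw j).le) (Finset.mem_univ k)
    · rintro ⟨n, w, ⟨hw, h1⟩, h2⟩
      refine ⟨w, fun k => ?_, h1, h2⟩
      have := (hw k (Set.mem_univ k)).1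
      have h0 : (0 : ℝ) < 1 / ((n : ℝ) + 1) := by positivity
      exact h0.trans_le this
  rw [key]
  refine MeasurableSet.iUnion fun n => IsClosed.measurableSet ?_
  have : CompactSpace (K n) := isCompact_iff_compactSpace.1 (hK n)
  have hc : IsClosed {p : (ι → EuclideanSpace ℝ (Fin d)) × K n |
      ∑ k, (p.2 : ι → ℝ) k • p.1 k = minCenter p.1} := by
    have := continuous_minCenter (ι := ι) (d := d)
    refine isClosed_eq (continuous_finsetSum _ fun k _ => ?_) (by fun_prop)
    exact ((continuous_apply k).comp (continuous_subtype_val.comp continuous_snd)).smul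
      ((continuous_apply k).comp continuous_fst)
  convert! isClosedMap_fst_of_compactSpace _ hc using 1
  ext y
  simp

end MinimalBall

/-- The critical configurations of `S` with center in `B`. -/
def critConfigs (i j : ℕ) (B S : Set (EuclideanSpace ℝ (Fin d))) :
    Set (Finset (EuclideanSpace ℝ (Fin d))) :=
  {Y | ↑Y ⊆ S ∧ Y.card = i + 1 ∧
    ∃ c ρ, IsMinBall (↑Y) c ρ ∧ c ∈ B ∧ MemOpenSimplex Y c ∧ (S ∩ ball c ρ).ncard = j}

lemma memOpenSimplex_minCenter_iff {ι : Type*} [Fintype ι] [Nonempty ι]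
    {y : ι → EuclideanSpace ℝ (Fin d)} (hy : Function.Injective y)
    {Y : Finset (EuclideanSpace ℝ (Fin d))} (hY : (Y : Set _) = Set.range y) :
    MemOpenSimplex Y (minCenter y) ↔ CenterInSimplex y := by
  classical
  have hYi : Y = Finset.univ.image y := by
    apply Finset.coe_injective
    simpa using hY
  subst hYi
  unfold MemOpenSimplex CenterInSimplex
  simp only [Finset.sum_image hy.injOn, Finset.mem_image, Finset.mem_univ, true_and,
    forall_exists_index, forall_apply_eq_imp_iff]
  constructor
  · rintro ⟨w, h⟩
    exact ⟨w ∘ y, h⟩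
  · rintro ⟨w, h⟩
    exact ⟨Function.extend y w 0, by simpa [hy.extend_apply] using h⟩

lemma tsum_indicator_one_eq_encard {α : Type*} (s : Set α) :
    ∑' a, s.indicator (1 : α → ℝ≥0∞) a = (s.encard : ℝ≥0∞) := by
  rw [← ENNReal.tsum_set_one, ← tsum_subtype]
  rfl

section CritMeasure

variable {f : EuclideanSpace ℝ (Fin d) → ℝ} (hf : Measurable f) (hinj : Function.Injective f)
  (hbd : ∀ q, Bornology.IsBounded {x | f x < q})

include hf hinj hbd in
lemma measurableSet_ncard_inter_ball_eq
    {c : LocFin (EuclideanSpace ℝ (Fin d)) → EuclideanSpace ℝ (Fin d)}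
    {r : LocFin (EuclideanSpace ℝ (Fin d)) → ℝ} (hc : Measurable c) (hr : Measurable r) (j : ℕ) :
    MeasurableSet {S : LocFin (EuclideanSpace ℝ (Fin d)) |
      (S.1 ∩ ball (c S) (r S)).ncard = j} := by
  let T : ℕ → Set (LocFin (EuclideanSpace ℝ (Fin d))) := fun k =>
    hasRank f k ∩ {S | dist (pointOfRank f k S) (c S) < r S}
  have hT : ∀ k, MeasurableSet (T k) := fun k =>
    (measurableSet_hasRank hf hinj hbd k).inter
      (measurableSet_lt ((measurable_pointOfRank hf hinj hbd k).dist hc) hr)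
  have hcount : ∀ S : LocFin (EuclideanSpace ℝ (Fin d)),
      ∑' k, (T k).indicator (1 : LocFin _ → ℝ≥0∞) S = ((S.1 ∩ ball (c S) (r S)).encard : ℝ≥0∞) := by
    intro S
    have h1 : ∀ k, (T k).indicator 1 S =
        {k | S ∈ T k}.indicator (1 : ℕ → ℝ≥0∞) k := fun k => rfl
    simp_rw [h1]
    rw [tsum_indicator_one_eq_encard]
    congr 1
    have himg : S.1 ∩ ball (c S) (r S) = (fun k => pointOfRank f k S) '' {k | S ∈ T k} := by
      ext x
      constructor
      · rintro ⟨hx, hxb⟩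
        refine ⟨rankIn f S x, ⟨⟨x, hx, rfl⟩, ?_⟩, pointOfRank_rankIn hinj hbd hx⟩
        rw [Set.mem_ofPred_eq, pointOfRank_rankIn hinj hbd hx]
        exact hxb
      · rintro ⟨k, ⟨hk, hk'⟩, rfl⟩
        exact ⟨(pointOfRank_spec hk).1, hk'⟩
    rw [himg, Set.InjOn.encard_image]
    intro k hk l hl h
    rw [← (pointOfRank_spec hk.1).2, ← (pointOfRank_spec hl.1).2]
    exact congrArg _ h
  have hmeas : Measurable fun S => ∑' k, (T k).indicator (1 : LocFin _ → ℝ≥0∞) S :=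
    Measurable.tsum fun k => measurable_one.indicator (hT k)
  convert! hmeas (measurableSet_singleton (j : ℝ≥0∞)) using 1
  ext S
  have hfin : (S.1 ∩ ball (c S) (r S)).Finite := S.2 _ isBounded_ball
  rw [Set.mem_ofPred_eq, Set.mem_preimage, Set.mem_singleton_iff, hcount, ← hfin.cast_ncard_eq]
  norm_cast

/-- The family of points of `S` with ranks in `I`. -/
def pointsOfRanks (f : EuclideanSpace ℝ (Fin d) → ℝ) (I : Finset ℕ)
    (S : LocFin (EuclideanSpace ℝ (Fin d))) : I → EuclideanSpace ℝ (Fin d) :=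
  fun k => pointOfRank f k S

include hf hinj hbd in
lemma measurable_pointsOfRanks (I : Finset ℕ) : Measurable (pointsOfRanks f I) :=
  measurable_pi_lambda _ fun k => measurable_pointOfRank hf hinj hbd k

instance (i : ℕ) (I : {I : Finset ℕ // I.card = i + 1}) : Nonempty I.1 :=
  (Finset.card_pos.1 (by rw [I.2]; omega)).to_subtype

/-- The event that the points with ranks in `I` exist and are a critical configuration. -/
def critEvent (f : EuclideanSpace ℝ (Fin d) → ℝ) (i j : ℕ)
    (I : {I : Finset ℕ // I.card = i + 1}) : Set (LocFin (EuclideanSpace ℝ (Fin d))) :=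
  (⋂ k : I.1, hasRank f k) ∩ ({S | CenterInSimplex (pointsOfRanks f I.1 S)} ∩
    {S | (S.1 ∩ ball (minCenter (pointsOfRanks f I.1 S))
      (minRadius (pointsOfRanks f I.1 S))).ncard = j})

include hf hinj hbd in
lemma measurable_minCenter_pointsOfRanks {i : ℕ} (I : {I : Finset ℕ // I.card = i + 1}) :
    Measurable fun S => minCenter (pointsOfRanks f I.1 S) :=
  continuous_minCenter.measurable.comp (measurable_pointsOfRanks hf hinj hbd I.1)

include hf hinj hbd in
lemma measurableSet_critEvent (i j : ℕ) (I : {I : Finset ℕ // I.card = i + 1}) :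
    MeasurableSet (critEvent f i j I) := by
  have h := measurable_pointsOfRanks hf hinj hbd I.1
  refine (MeasurableSet.iInter fun k => measurableSet_hasRank hf hinj hbd _).inter
    ((h measurableSet_centerInSimplex).inter
      (measurableSet_ncard_inter_ball_eq hf hinj hbd
        (measurable_minCenter_pointsOfRanks hf hinj hbd I)
        (continuous_minRadius.measurable.comp h) j))

include hinj hbd in
lemma encard_critConfigs_eq_tsum (i j : ℕ) (B : Set (EuclideanSpace ℝ (Fin d)))
    (S : LocFin (EuclideanSpace ℝ (Fin d))) :
    ((critConfigs i j B S.1).encard : ℝ≥0∞) =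
      ∑' I : {I : Finset ℕ // I.card = i + 1},
        (critEvent f i j I ∩ (fun S => minCenter (pointsOfRanks f I.1 S)) ⁻¹' B).indicator
          1 S := by
  classical
  set Z : Set {I : Finset ℕ // I.card = i + 1} :=
    {I | S ∈ critEvent f i j I ∧ minCenter (pointsOfRanks f I.1 S) ∈ B} with hZ
  have h1 : ∀ I : {I : Finset ℕ // I.card = i + 1},
      (critEvent f i j I ∩ (fun S => minCenter (pointsOfRanks f I.1 S)) ⁻¹' B).indicator
        (1 : LocFin _ → ℝ≥0∞) S = Z.indicator 1 I := fun I => by simp [Set.indicator, hZ]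
  simp_rw [h1]
  rw [tsum_indicator_one_eq_encard]
  congr 1
  have hrank : ∀ I ∈ Z, ∀ k ∈ I.1, S ∈ hasRank f k := fun I hI k hk =>
    Set.mem_iInter.1 hI.1.1 ⟨k, hk⟩
  have hinjI : ∀ I : {I : Finset ℕ // I.card = i + 1}, (∀ k ∈ I.1, S ∈ hasRank f k) →
      Set.InjOn (fun k => pointOfRank f k S) I.1 := by
    intro I hI k hk l hl h
    rw [← (pointOfRank_spec (hI k hk)).2, ← (pointOfRank_spec (hI l hl)).2]
    exact congrArg _ h
  have hrange : ∀ I : {I : Finset ℕ // I.card = i + 1},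
      ((I.1.image fun k => pointOfRank f k S : Finset _) : Set _) =
        Set.range (pointsOfRanks f I.1 S) := by
    intro I
    ext x
    simp [pointsOfRanks]
  have hrec : ∀ I ∈ Z, (I.1.image fun k => pointOfRank f k S).image (rankIn f S) = I.1 := by
    intro I hI
    rw [Finset.image_image]
    refine (Finset.image_congr fun k hk => ?_).trans Finset.image_id
    exact (pointOfRank_spec (hrank I hI k hk)).2
  have himg : critConfigs i j B S.1 =
      (fun I : {I : Finset ℕ // I.card = i + 1} =>
        I.1.image fun k => pointOfRank f k S) '' Z := by
    ext Y
    constructor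
    · rintro ⟨hYS, hcard, c, ρ, hmin, hcB, hsimp, hj⟩
      have hinjY : Set.InjOn (rankIn f S) (Y : Set _) := (rankIn_injOn hinj hbd S).mono hYS
      obtain ⟨I, hIdef⟩ : ∃ I : {I : Finset ℕ // I.card = i + 1}, I.1 = Y.image (rankIn f S) :=
        ⟨⟨Y.image (rankIn f S), by rw [Finset.card_image_of_injOn hinjY, hcard]⟩, rfl⟩
      have hIr : ∀ k ∈ I.1, S ∈ hasRank f k := by
        intro k hk
        obtain ⟨x, hx, rfl⟩ := Finset.mem_image.1 (hIdef ▸ hk)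
        exact ⟨x, hYS hx, rfl⟩
      have hIY : (I.1.image fun k => pointOfRank f k S) = Y := by
        rw [hIdef, Finset.image_image]
        refine (Finset.image_congr fun x hx => ?_).trans Finset.image_id
        exact pointOfRank_rankIn hinj hbd (hYS hx)
      have hy : Function.Injective (pointsOfRanks f I.1 S) := fun k l h =>
        Subtype.ext (hinjI I hIr k.2 l.2 h)
      have hYr : (Y : Set _) = Set.range (pointsOfRanks f I.1 S) := by rw [← hrange, hIY]
      rw [hYr, isMinBall_range_iff] at hmin
      obtain ⟨rfl, rfl⟩ := hmin
      rw [memOpenSimplex_minCenter_iff hy hYr] at hsimp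
      exact ⟨I, ⟨⟨Set.mem_iInter.2 fun k => hIr k k.2, hsimp, hj⟩, hcB⟩, hIY⟩
    · rintro ⟨I, hI, rfl⟩
      have hIr := hrank I hI
      have hy : Function.Injective (pointsOfRanks f I.1 S) := fun k l h =>
        Subtype.ext (hinjI I hIr k.2 l.2 h)
      refine ⟨?_, ?_, minCenter (pointsOfRanks f I.1 S), minRadius (pointsOfRanks f I.1 S),
        ?_, hI.2, ?_, hI.1.2.2⟩
      · intro x hx
        obtain ⟨k, hk, rfl⟩ := Finset.mem_image.1 hx
        exact (pointOfRank_spec (hIr k hk)).1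
      · rw [Finset.card_image_of_injOn (hinjI I hIr), I.2]
      · rw [hrange, isMinBall_range_iff]
        exact ⟨rfl, rfl⟩
      · rw [memOpenSimplex_minCenter_iff hy (hrange I)]
        exact hI.1.2.1
  rw [himg, Set.InjOn.encard_image]
  intro I hI J hJ h
  apply Subtype.ext
  rw [← hrec I hI, ← hrec J hJ]
  exact congrArg _ h

end CritMeasure

lemma measurable_encard_critConfigs (i j : ℕ) {B : Set (EuclideanSpace ℝ (Fin d))}
    (hB : MeasurableSet B) : Measurable fun S : LocFin (EuclideanSpace ℝ (Fin d)) =>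
      ((critConfigs i j B S.1).encard : ℝ≥0∞) := by
  obtain ⟨f, hf, hinj, hbd⟩ :=
    exists_measurable_injective_bounded_sublevel (E := EuclideanSpace ℝ (Fin d))
  simp_rw [encard_critConfigs_eq_tsum hinj hbd]
  exact Measurable.tsum fun I => measurable_one.indicator
    ((measurableSet_critEvent hf hinj hbd i j I).inter
      (measurable_minCenter_pointsOfRanks hf hinj hbd I hB))

/-- The expected number of critical configurations is a measure in the set of centers. -/
lemma exists_measure_lintegral_encard_critConfigs (i j : ℕ)
    (P : Measure (LocFin (EuclideanSpace ℝ (Fin d)))) :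
    ∃ M : Measure (EuclideanSpace ℝ (Fin d)), ∀ B, MeasurableSet B →
      M B = ∫⁻ S, ((critConfigs i j B S.1).encard : ℝ≥0∞) ∂P := by
  obtain ⟨f, hf, hinj, hbd⟩ :=
    exists_measurable_injective_bounded_sublevel (E := EuclideanSpace ℝ (Fin d))
  refine ⟨Measure.sum fun I : {I : Finset ℕ // I.card = i + 1} =>
    (P.restrict (critEvent f i j I)).map fun S => minCenter (pointsOfRanks f I.1 S),
    fun B hB => ?_⟩
  have hc := fun I => measurable_minCenter_pointsOfRanks hf hinj hbd (i := i) I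
  have he := measurableSet_critEvent hf hinj hbd i j
  simp_rw [encard_critConfigs_eq_tsum hinj hbd]
  rw [lintegral_tsum fun I => (measurable_one.indicator ((he I).inter (hc I hB))).aemeasurable,
    Measure.sum_apply _ hB]
  refine tsum_congr fun I => ?_
  rw [lintegral_indicator_one ((he I).inter (hc I hB)), Measure.map_apply (hc I) hB,
    Measure.restrict_apply (hc I hB), Set.inter_comm]

/-- The similarity `x ↦ t • x + v` of ratio `t`. -/
def similarity (t : ℝ) (v x : EuclideanSpace ℝ (Fin d)) : EuclideanSpace ℝ (Fin d) := t • x + v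

section Similarity

variable {t : ℝ} (ht : 0 < t) (v : EuclideanSpace ℝ (Fin d))

include ht in
lemma similarity_inv_similarity (x : EuclideanSpace ℝ (Fin d)) :
    similarity t⁻¹ (-(t⁻¹ • v)) (similarity t v x) = x := by
  simp [similarity, smul_add, smul_smul, ht.ne']

include ht in
lemma similarity_similarity_inv (x : EuclideanSpace ℝ (Fin d)) :
    similarity t v (similarity t⁻¹ (-(t⁻¹ • v)) x) = x := by
  simp [similarity, smul_add, smul_smul, ht.ne']

include ht in
lemma similarity_injective : Function.Injective (similarity t v) :=
  Function.LeftInverse.injective (similarity_inv_similarity ht v)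

include ht in
lemma dist_similarity (x y : EuclideanSpace ℝ (Fin d)) :
    dist (similarity t v x) (similarity t v y) = t * dist x y := by
  simp [similarity, dist_smul₀, abs_of_pos ht]

lemma continuous_similarity : Continuous (similarity t v) := by
  unfold similarity; fun_prop

include ht in
lemma image_similarity (A : Set (EuclideanSpace ℝ (Fin d))) :
    similarity t v '' A = similarity t⁻¹ (-(t⁻¹ • v)) ⁻¹' A :=
  congrFun (Set.image_eq_preimage_of_inverse (similarity_inv_similarity ht v)
    (similarity_similarity_inv ht v)) A

include ht in
lemma isBounded_preimage_similarity {A : Set (EuclideanSpace ℝ (Fin d))}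
    (hA : Bornology.IsBounded A) : Bornology.IsBounded (similarity t v ⁻¹' A) := by
  obtain ⟨C, hC⟩ := isBounded_iff.1 hA
  refine isBounded_iff.2 ⟨C / t, fun x hx y hy => ?_⟩
  have := hC hx hy
  rw [dist_similarity ht] at this
  rw [le_div_iff₀ ht]
  linarith

include ht in
lemma volume_preimage_similarity (A : Set (EuclideanSpace ℝ (Fin d))) :
    volume (similarity t v ⁻¹' A) = ENNReal.ofReal ((t ^ d)⁻¹) * volume A := by
  have h : similarity t v ⁻¹' A = (t • ·) ⁻¹' ((· + v) ⁻¹' A) := rfl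
  rw [h, Measure.addHaar_preimage_smul _ ht.ne', measure_preimage_add_right,
    finrank_euclideanSpace_fin, abs_of_pos (by positivity)]

include ht in
lemma IsMinBall.image_similarity {Y : Set (EuclideanSpace ℝ (Fin d))}
    {c : EuclideanSpace ℝ (Fin d)} {ρ : ℝ} (h : IsMinBall Y c ρ) :
    IsMinBall (similarity t v '' Y) (similarity t v c) (t * ρ) := by
  refine ⟨?_, fun c' ρ' h' => ?_⟩
  · rintro _ ⟨x, hx, rfl⟩
    rw [mem_closedBall, dist_similarity ht]
    exact mul_le_mul_of_nonneg_left (h.1 hx) ht.le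
  · rw [← le_div_iff₀' ht]
    refine h.2 (similarity t⁻¹ (-(t⁻¹ • v)) c') _ fun x hx => ?_
    have := mem_closedBall.1 (h' ⟨x, hx, rfl⟩)
    rw [← similarity_similarity_inv ht v c', dist_similarity ht] at this
    rw [mem_closedBall, le_div_iff₀' ht]
    exact this

include ht in
lemma MemOpenSimplex.map_similarity {Y : Finset (EuclideanSpace ℝ (Fin d))}
    {c : EuclideanSpace ℝ (Fin d)} (h : MemOpenSimplex Y c) :
    MemOpenSimplex (Y.map ⟨similarity t v, similarity_injective ht v⟩) (similarity t v c) := by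
  obtain ⟨w, hw, h1, h2⟩ := h
  refine ⟨fun x => w (similarity t⁻¹ (-(t⁻¹ • v)) x), ?_, ?_, ?_⟩
  · intro q hq
    obtain ⟨x, hx, rfl⟩ := Finset.mem_map.1 hq
    simpa [similarity_inv_similarity ht v] using hw x hx
  · simpa [similarity_inv_similarity ht v] using h1
  · simp only [Finset.sum_map, Function.Embedding.coeFn_mk, similarity_inv_similarity ht v]
    simp only [similarity, smul_add, Finset.sum_add_distrib, ← Finset.sum_smul, h1, one_smul,
      ← h2, Finset.smul_sum, smul_comm t]

include ht in
lemma encard_critConfigs_le_image_similarity (i j : ℕ) (B S : Set (EuclideanSpace ℝ (Fin d))) :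
    (critConfigs i j B S).encard ≤
      (critConfigs i j (similarity t v '' B) (similarity t v '' S)).encard := by
  rw [← (Finset.map_injective ⟨similarity t v, similarity_injective ht v⟩).encard_image]
  refine Set.encard_le_encard ?_
  rintro _ ⟨Y, ⟨hYS, hcard, c, ρ, hmin, hcB, hsimp, hj⟩, rfl⟩
  refine ⟨?_, by simpa using hcard, similarity t v c, t * ρ, ?_, ⟨c, hcB, rfl⟩,
    hsimp.map_similarity ht v, ?_⟩
  · rw [Finset.coe_map]
    exact Set.image_mono hYS
  · rw [Finset.coe_map]
    exact hmin.image_similarity ht v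
  · have : similarity t v '' S ∩ ball (similarity t v c) (t * ρ) =
        similarity t v '' (S ∩ ball c ρ) := by
      ext x
      constructor
      · rintro ⟨⟨y, hy, rfl⟩, hb⟩
        rw [mem_ball, dist_similarity ht] at hb
        exact ⟨y, ⟨hy, lt_of_mul_lt_mul_left hb ht.le⟩, rfl⟩
      · rintro ⟨y, ⟨hy, hb⟩, rfl⟩
        refine ⟨⟨y, hy, rfl⟩, ?_⟩
        rw [mem_ball, dist_similarity ht]
        exact mul_lt_mul_of_pos_left hb ht
    rw [this, Set.ncard_image_of_injective _ (similarity_injective ht v), hj]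

include ht in
lemma encard_critConfigs_image_similarity (i j : ℕ) (B S : Set (EuclideanSpace ℝ (Fin d))) :
    (critConfigs i j (similarity t v '' B) (similarity t v '' S)).encard =
      (critConfigs i j B S).encard := by
  refine le_antisymm ?_ (encard_critConfigs_le_image_similarity ht v i j B S)
  have h := encard_critConfigs_le_image_similarity (inv_pos.2 ht) (-(t⁻¹ • v)) i j
    (similarity t v '' B) (similarity t v '' S)
  simpa only [Set.image_image, similarity_inv_similarity ht v, Set.image_id'] using h

/-- The image of a locally finite set under a similarity. -/
def LocFin.imageSimilarity (S : LocFin (EuclideanSpace ℝ (Fin d))) :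
    LocFin (EuclideanSpace ℝ (Fin d)) :=
  ⟨similarity t v '' S.1, fun A hA => by
    rw [← Set.image_inter_preimage]
    exact (S.2 _ (isBounded_preimage_similarity ht v hA)).image _⟩

lemma preimage_imageSimilarity_void (A : Set (EuclideanSpace ℝ (Fin d))) :
    LocFin.imageSimilarity ht v ⁻¹' {S | S.1 ∩ A = ∅} =
      {S | S.1 ∩ similarity t v ⁻¹' A = ∅} := by
  ext S
  change similarity t v '' S.1 ∩ A = ∅ ↔ S.1 ∩ similarity t v ⁻¹' A = ∅
  rw [← Set.image_inter_preimage, Set.image_eq_empty]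

lemma measurable_imageSimilarity : Measurable (LocFin.imageSimilarity ht v) := by
  refine measurable_generateFrom ?_
  rintro _ ⟨A, hA, hb, rfl⟩
  rw [preimage_imageSimilarity_void]
  exact MeasurableSpace.measurableSet_generateFrom
    ⟨_, (continuous_similarity v).measurable hA, isBounded_preimage_similarity ht v hb, rfl⟩

end Similarity

/-- The void probabilities of a homogeneous Poisson process of intensity `ν`. -/
def HasPoissonVoidProb (P : Measure (LocFin (EuclideanSpace ℝ (Fin d)))) (ν : ℝ≥0) : Prop :=
  ∀ A, MeasurableSet A → Bornology.IsBounded A →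
    P {S | S.1 ∩ A = ∅} = ENNReal.ofReal (Real.exp (-(ν * (volume A).toReal)))

lemma isPiSystem_voidEvents (E : Type*) [Bornology E] [MeasurableSpace E] :
    IsPiSystem (voidEvents E) := by
  rintro _ ⟨A, hA, hAb, rfl⟩ _ ⟨B, hB, hBb, rfl⟩ -
  refine ⟨A ∪ B, hA.union hB, hAb.union hBb, ?_⟩
  ext S
  simp [Set.inter_union_distrib_left]

lemma HasPoissonVoidProb.unique {P Q : Measure (LocFin (EuclideanSpace ℝ (Fin d)))}
    [IsProbabilityMeasure P] [IsProbabilityMeasure Q] {ν : ℝ≥0}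
    (hP : HasPoissonVoidProb P ν) (hQ : HasPoissonVoidProb Q ν) : P = Q := by
  refine ext_of_generate_finite (voidEvents _) rfl (isPiSystem_voidEvents _) ?_ (by simp)
  rintro _ ⟨A, hA, hAb, rfl⟩
  rw [hP A hA hAb, hQ A hA hAb]

lemma HasPoissonVoidProb.map_similarity {P : Measure (LocFin (EuclideanSpace ℝ (Fin d)))}
    {ν ν₀ : ℝ≥0} (hP : HasPoissonVoidProb P ν) {t : ℝ} (ht : 0 < t)
    (v : EuclideanSpace ℝ (Fin d)) (hν : (ν : ℝ) = ν₀ * t ^ d) :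
    HasPoissonVoidProb (P.map (LocFin.imageSimilarity ht v)) ν₀ := by
  intro A hA hb
  rw [Measure.map_apply (measurable_imageSimilarity ht v)
    (MeasurableSpace.measurableSet_generateFrom ⟨A, hA, hb, rfl⟩),
    preimage_imageSimilarity_void, hP _ ((continuous_similarity v).measurable hA)
      (isBounded_preimage_similarity ht v hb), volume_preimage_similarity ht,
    ENNReal.toReal_mul, ENNReal.toReal_ofReal (by positivity), hν]
  congr 3
  field_simp

/-- Expected numbers of critical configurations transform under similarities. -/
lemma lintegral_encard_critConfigs_similarity
    {P Q : Measure (LocFin (EuclideanSpace ℝ (Fin d)))}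
    [IsProbabilityMeasure P] [IsProbabilityMeasure Q] {ν ν₀ : ℝ≥0}
    (hP : HasPoissonVoidProb P ν) (hQ : HasPoissonVoidProb Q ν₀) {t : ℝ} (ht : 0 < t)
    (v : EuclideanSpace ℝ (Fin d)) (hν : (ν : ℝ) = ν₀ * t ^ d) (i j : ℕ)
    {B : Set (EuclideanSpace ℝ (Fin d))} (hB : MeasurableSet B) :
    ∫⁻ S, ((critConfigs i j (similarity t v '' B) S.1).encard : ℝ≥0∞) ∂Q =
      ∫⁻ S, ((critConfigs i j B S.1).encard : ℝ≥0∞) ∂P := by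
  have hm := measurable_imageSimilarity ht v
  have : IsProbabilityMeasure (P.map (LocFin.imageSimilarity ht v)) :=
    Measure.isProbabilityMeasure_map hm.aemeasurable
  rw [hQ.unique (hP.map_similarity ht v hν), lintegral_map _ hm]
  · simp_rw [LocFin.imageSimilarity, encard_critConfigs_image_similarity ht]
  · apply measurable_encard_critConfigs
    rw [image_similarity ht]
    exact (continuous_similarity _).measurable hB

lemma lintegral_pow_poissonMeasure (r s : ℝ≥0) :
    ∫⁻ n, (s : ℝ≥0∞) ^ n ∂(poissonMeasure r) = ENNReal.ofReal (Real.exp (r * (s - 1))) := by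
  rw [lintegral_countable']
  have h := (hasSum_one_poissonMeasure (r * s)).mul_left (Real.exp (r * (s - 1)))
  rw [mul_one] at h
  rw [← h.tsum_eq, ENNReal.ofReal_tsum_of_nonneg (fun n => by positivity) h.summable]
  refine tsum_congr fun n => ?_
  rw [poissonMeasure_singleton, ← ENNReal.ofReal_coe_nnreal, ← ENNReal.ofReal_pow s.coe_nonneg,
    ← ENNReal.ofReal_mul (by positivity)]
  congr 1
  have : Real.exp (-(r : ℝ)) = Real.exp (r * (s - 1)) * Real.exp (-(r * s : ℝ≥0)) := by
    rw [← Real.exp_add]; congr 1; push_cast; ring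
  rw [this]
  push_cast
  ring

lemma choose_le_inv_pow_mul {a : ℝ≥0} (ha : 0 < a) (N m : ℕ) :
    (N.choose m : ℝ≥0) ≤ a⁻¹ ^ m * (1 + a) ^ N := by
  rw [inv_pow, inv_mul_eq_div, le_div_iff₀ (by positivity), add_comm 1 a, add_pow]
  rcases le_or_gt m N with h | h
  · refine le_trans (le_of_eq ?_) (Finset.single_le_sum (f := fun k =>
      a ^ k * 1 ^ (N - k) * (N.choose k : ℝ≥0)) (fun _ _ => zero_le) (Finset.mem_range.2
        (Nat.lt_succ_of_le h)))
    ring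
  · simp [Nat.choose_eq_zero_of_lt h]

lemma encard_setOf_subset_card_eq {α : Type*} {T : Set α} (hT : T.Finite) (m : ℕ) :
    {Y : Finset α | ↑Y ⊆ T ∧ Y.card = m}.encard = T.ncard.choose m := by
  have : {Y : Finset α | ↑Y ⊆ T ∧ Y.card = m} = (hT.toFinset.powersetCard m : Set (Finset α)) := by
    ext Y
    simp [Finset.mem_powersetCard, Finset.subset_iff, Set.subset_def]
  rw [this, Set.encard_coe_eq_coe_finsetCard, Finset.card_powersetCard,
    Set.ncard_eq_toFinset_card T hT]

lemma encard_iUnion_le_tsum {α : Type*} (T : ℕ → Set α) :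
    ((⋃ n, T n).encard : ℝ≥0∞) ≤ ∑' n, ((T n).encard : ℝ≥0∞) := by
  let _ : MeasurableSpace α := ⊤
  simpa only [Measure.count_apply MeasurableSpace.measurableSet_top] using
    measure_iUnion_le (μ := Measure.count) T

/-- Critical configurations with center near the origin are sorted by radius: one of radius
about `n` lies in a ball of radius `n + 3`, while the ball of radius `n` is almost empty. -/
lemma encard_critConfigs_ball_le (i j : ℕ) (S : LocFin (EuclideanSpace ℝ (Fin d)))
    {a : ℝ≥0} (ha : 0 < a) :
    ((critConfigs i j (ball 0 1) S.1).encard : ℝ≥0∞) ≤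
      ∑' n : ℕ, (a⁻¹ ^ (i + 1) * 2 ^ j : ℝ≥0) *
        ((((1 + a) / 2 : ℝ≥0) : ℝ≥0∞) ^ (S.1 ∩ ball 0 (n : ℝ)).ncard *
          ((1 + a : ℝ≥0) : ℝ≥0∞) ^ (S.1 ∩ (closedBall 0 (n + 3 : ℝ) \ ball 0 (n : ℝ))).ncard) := by
  let T : ℕ → Set (Finset (EuclideanSpace ℝ (Fin d))) := fun n =>
    {Y | (↑Y ⊆ S.1 ∩ closedBall 0 (n + 3 : ℝ) ∧ Y.card = i + 1) ∧
      (S.1 ∩ ball 0 (n : ℝ)).ncard ≤ j}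
  have hsub : critConfigs i j (ball 0 1) S.1 ⊆ ⋃ n, T n := by
    rintro Y ⟨hYS, hcard, c, ρ, hmin, hc, -, hj⟩
    have hYne : Y.Nonempty := Finset.card_pos.1 (by omega)
    obtain ⟨y, hy⟩ := hYne
    have hρ : 0 ≤ ρ := dist_nonneg.trans (mem_closedBall.1 (hmin.1 hy))
    have h1 := Nat.lt_floor_add_one ρ
    have h2 := Nat.floor_le hρ
    rw [mem_ball] at hc
    refine Set.mem_iUnion.2 ⟨⌊ρ⌋₊ - 1, ⟨fun x hx => ⟨hYS hx, ?_⟩, hcard⟩, ?_⟩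
    · have hx' := mem_closedBall.1 (hmin.1 hx)
      have h3 : (⌊ρ⌋₊ : ℝ) ≤ ((⌊ρ⌋₊ - 1 : ℕ) : ℝ) + 1 := by
        have : ⌊ρ⌋₊ ≤ ⌊ρ⌋₊ - 1 + 1 := by omega
        exact_mod_cast this
      rw [mem_closedBall]
      linarith [dist_triangle x c 0]
    · rw [← hj]
      refine Set.ncard_le_ncard (fun x hx => ⟨hx.1, ?_⟩) (S.2 _ isBounded_ball)
      have hx' := mem_ball.1 hx.2
      rcases Nat.eq_zero_or_pos ⌊ρ⌋₊ with h | h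
      · rw [h] at hx'
        simp at hx'
        exact absurd hx' (not_lt.2 (norm_nonneg _))
      · rw [Nat.cast_sub h, Nat.cast_one] at hx'
        rw [mem_ball]
        linarith [dist_triangle x 0 c, dist_comm c 0]
  refine le_trans ?_ ((encard_iUnion_le_tsum T).trans (ENNReal.tsum_le_tsum fun n => ?_))
  · exact_mod_cast Set.encard_le_encard hsub
  set N := (S.1 ∩ closedBall 0 (n + 3 : ℝ)).ncard with hN
  set N₁ := (S.1 ∩ ball 0 (n : ℝ)).ncard with hN₁
  set N₂ := (S.1 ∩ (closedBall 0 (n + 3 : ℝ) \ ball 0 (n : ℝ))).ncard with hN₂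
  have hadd : N = N₁ + N₂ := by
    rw [hN, hN₁, hN₂, ← Set.ncard_union_eq _ (S.2 _ isBounded_ball)
      (S.2 _ (isBounded_closedBall.subset Set.sdiff_subset))]
    · congr 1
      rw [← Set.inter_union_distrib_left, Set.union_sdiff_cancel]
      exact ball_subset_closedBall.trans (closedBall_subset_closedBall (by linarith))
    · exact Set.disjoint_sdiff_right.mono Set.inter_subset_right Set.inter_subset_right
  by_cases hj : N₁ ≤ j
  · have hT : T n = {Y : Finset (EuclideanSpace ℝ (Fin d)) |
        ↑Y ⊆ S.1 ∩ closedBall 0 (n + 3 : ℝ) ∧ Y.card = i + 1} := by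
      ext Y
      exact and_iff_left hj
    rw [hT, encard_setOf_subset_card_eq (S.2 _ isBounded_closedBall)]
    have key : (N.choose (i + 1) : ℝ≥0) ≤
        a⁻¹ ^ (i + 1) * 2 ^ j * (((1 + a) / 2) ^ N₁ * (1 + a) ^ N₂) := by
      refine (choose_le_inv_pow_mul ha N (i + 1)).trans ?_
      have h2 : (1 + a) ^ N₁ ≤ 2 ^ j * ((1 + a) / 2) ^ N₁ := by
        calc (1 + a) ^ N₁ = 2 ^ N₁ * ((1 + a) / 2) ^ N₁ := by
              rw [← mul_pow, mul_div_cancel₀ _ two_ne_zero]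
          _ ≤ _ := by gcongr; norm_num
      calc a⁻¹ ^ (i + 1) * (1 + a) ^ N = a⁻¹ ^ (i + 1) * ((1 + a) ^ N₁ * (1 + a) ^ N₂) := by
            rw [hadd, pow_add (1 + a)]
        _ ≤ a⁻¹ ^ (i + 1) * ((2 ^ j * ((1 + a) / 2) ^ N₁) * (1 + a) ^ N₂) := by gcongr
        _ = _ := by ring
    have key' := ENNReal.coe_le_coe.2 key
    rw [ENNReal.coe_mul (_ * _), ENNReal.coe_mul (_ ^ _) (_ ^ N₂), ENNReal.coe_pow _ N₁,
      ENNReal.coe_pow _ N₂] at key'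
    simpa using key'
  · have hT : T n = ∅ := Set.eq_empty_of_forall_notMem fun Y hY => hj hY.2
    simp [hT]

section Poisson

variable {Ωs : Type} [MeasurableSpace Ωs] {μ : Measure Ωs}
  {X : Ωs → Set (EuclideanSpace ℝ (Fin d))} {ν : ℝ≥0} (h : IsHomPoissonPP μ X ν)

/-- A Poisson process as a map to the space of locally finite sets. -/
def IsHomPoissonPP.toLocFin (ω : Ωs) : LocFin (EuclideanSpace ℝ (Fin d)) :=
  ⟨X ω, h.locallyFinite ω⟩

lemma IsHomPoissonPP.toLocFin_preimage_void {A : Set (EuclideanSpace ℝ (Fin d))}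
    (hb : Bornology.IsBounded A) : h.toLocFin ⁻¹' {S | S.1 ∩ A = ∅} =
      (fun ω => (X ω ∩ A).ncard) ⁻¹' {0} := by
  ext ω
  change X ω ∩ A = ∅ ↔ (X ω ∩ A).ncard = 0
  rw [Set.ncard_eq_zero (h.locallyFinite ω A hb)]

lemma IsHomPoissonPP.measurable_toLocFin : Measurable h.toLocFin := by
  refine measurable_generateFrom ?_
  rintro _ ⟨A, hA, hb, rfl⟩
  rw [h.toLocFin_preimage_void hb]
  exact h.counts_measurable A hA (measurableSet_singleton 0)

lemma IsHomPoissonPP.hasPoissonVoidProb : HasPoissonVoidProb (μ.map h.toLocFin) ν := by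
  intro A hA hb
  rw [Measure.map_apply h.measurable_toLocFin
    (MeasurableSpace.measurableSet_generateFrom ⟨A, hA, hb, rfl⟩), h.toLocFin_preimage_void hb,
    ← Measure.map_apply (h.counts_measurable A hA) (measurableSet_singleton 0),
    h.poisson_counts A hA hb.measure_lt_top.ne, poissonMeasure_singleton]
  simp
  rfl

include h in
lemma IsHomPoissonPP.lintegral_pow_ncard {A : Set (EuclideanSpace ℝ (Fin d))}
    (hA : MeasurableSet A) (hb : Bornology.IsBounded A) (s : ℝ≥0) :
    ∫⁻ ω, (s : ℝ≥0∞) ^ (X ω ∩ A).ncard ∂μ =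
      ENNReal.ofReal (Real.exp (ν * (volume A).toReal * (s - 1))) := by
  have := lintegral_map (μ := μ) (f := fun n : ℕ => (s : ℝ≥0∞) ^ n) measurable_from_nat
    (h.counts_measurable A hA)
  rw [← this, h.poisson_counts A hA hb.measure_lt_top.ne, lintegral_pow_poissonMeasure]
  rfl

include h in
lemma IsHomPoissonPP.lintegral_encard_critConfigs_ball_lt_top (hν : 0 < ν) (hd : 1 ≤ d)
    (i j : ℕ) :
    ∫⁻ ω, ((critConfigs i j (ball 0 1) (X ω)).encard : ℝ≥0∞) ∂μ < ⊤ := by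
  set a : ℝ≥0 := (4 ^ d)⁻¹ / 4 with ha_def
  have ha : 0 < a := by positivity
  have : Nonempty (Fin d) := ⟨⟨0, hd⟩⟩
  set κ : ℝ := (volume (ball (0 : EuclideanSpace ℝ (Fin d)) 1)).toReal with hκ
  have hκ0 : 0 < κ := ENNReal.toReal_pos (measure_ball_pos volume _ one_pos).ne'
    measure_ball_lt_top.ne
  have hvol : ∀ r : ℝ, 0 ≤ r →
      (volume (closedBall (0 : EuclideanSpace ℝ (Fin d)) r)).toReal = r ^ d * κ := by
    intro r hr
    rw [Measure.addHaar_closedBall _ _ hr, ENNReal.toReal_mul,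
      ENNReal.toReal_ofReal (by positivity), finrank_euclideanSpace_fin]
  have hvol' : ∀ r : ℝ, 0 ≤ r →
      (volume (ball (0 : EuclideanSpace ℝ (Fin d)) r)).toReal = r ^ d * κ := by
    intro r hr
    rw [Measure.addHaar_ball _ _ hr, ENNReal.toReal_mul,
      ENNReal.toReal_ofReal (by positivity), finrank_euclideanSpace_fin]
  set A : ℕ → Set (EuclideanSpace ℝ (Fin d)) := fun n => ball 0 (n : ℝ)
  set B : ℕ → Set (EuclideanSpace ℝ (Fin d)) := fun n => closedBall 0 (n + 3 : ℝ) \ ball 0 (n : ℝ)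
  have hA : ∀ n, MeasurableSet (A n) := fun n => measurableSet_ball
  have hB : ∀ n, MeasurableSet (B n) := fun n => measurableSet_closedBall.diff measurableSet_ball
  have hBb : ∀ n, Bornology.IsBounded (B n) := fun n =>
    isBounded_closedBall.subset Set.sdiff_subset
  have hm : ∀ (s : ℝ≥0) {C : Set (EuclideanSpace ℝ (Fin d))}, MeasurableSet C →
      Measurable fun ω => (s : ℝ≥0∞) ^ (X ω ∩ C).ncard := fun s C hC =>
    (measurable_from_nat (f := fun n : ℕ => (s : ℝ≥0∞) ^ n)).comp (h.counts_measurable C hC)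
  have hterm : ∀ n : ℕ, ∫⁻ ω, (((1 + a) / 2 : ℝ≥0) : ℝ≥0∞) ^ (X ω ∩ A n).ncard *
      ((1 + a : ℝ≥0) : ℝ≥0∞) ^ (X ω ∩ B n).ncard ∂μ ≤
        ENNReal.ofReal (Real.exp (ν * κ / 4) * Real.exp (n * (-(ν * κ / 8)))) := by
    intro n
    have hpow : ∀ s : ℝ≥0, Measurable fun k : ℕ => (s : ℝ≥0∞) ^ k := fun s => measurable_from_nat
    have hind := (h.indep_counts (A n) (B n) (hA n) (hB n) Set.disjoint_sdiff_right).comp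
      (hpow ((1 + a) / 2)) (hpow (1 + a))
    have hprod := lintegral_mul_eq_lintegral_mul_lintegral_of_indepFun (hm _ (hA n))
      (hm _ (hB n)) hind
    refine (le_of_eq hprod).trans ?_
    rw [h.lintegral_pow_ncard (hA n) isBounded_ball, h.lintegral_pow_ncard (hB n) (hBb n),
      ← ENNReal.ofReal_mul (by positivity), ← Real.exp_add, ← Real.exp_add]
    refine ENNReal.ofReal_le_ofReal (Real.exp_le_exp.2 ?_)
    have hBvol : (volume (B n)).toReal ≤ (n + 3 : ℝ) ^ d * κ := by
      rw [← hvol _ (by positivity)]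
      exact ENNReal.toReal_mono measure_closedBall_lt_top.ne (measure_mono Set.sdiff_subset)
    have hn : (n : ℝ) ≤ (n : ℝ) ^ d := by
      exact_mod_cast Nat.le_self_pow (by omega) n
    have h4 : (n + 3 : ℝ) ^ d ≤ 4 ^ d * ((n : ℝ) ^ d + 1) := by
      rcases Nat.eq_zero_or_pos n with rfl | hn0
      · have : (3 : ℝ) ^ d ≤ 4 ^ d := by gcongr; norm_num
        have h0 : (0 : ℝ) ^ d = 0 := zero_pow (by omega)
        simpa [h0] using this
      · have hn1 : (1 : ℝ) ≤ n := by exact_mod_cast hn0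
        calc (n + 3 : ℝ) ^ d ≤ (4 * n) ^ d := by gcongr; linarith
          _ = 4 ^ d * (n : ℝ) ^ d := mul_pow _ _ _
          _ ≤ _ := by gcongr; linarith
    have ha' : (a : ℝ) = (4 ^ d)⁻¹ / 4 := by simp [ha_def]
    have ha4 : (a : ℝ) * 4 ^ d = 1 / 4 := by rw [ha']; field_simp
    have ha1 : (a : ℝ) ≤ 1 / 4 := by
      have : (1 : ℝ) ≤ 4 ^ d := one_le_pow₀ (by norm_num)
      have ha0 : (0 : ℝ) < a := ha
      nlinarith
    have hBa : (volume (B n)).toReal * a ≤ ((n : ℝ) ^ d + 1) / 4 * κ := by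
      calc (volume (B n)).toReal * a ≤ (4 ^ d * ((n : ℝ) ^ d + 1) * κ) * a := by
            gcongr; exact hBvol.trans (by gcongr)
        _ = (a * 4 ^ d) * ((n : ℝ) ^ d + 1) * κ := by ring
        _ = _ := by rw [ha4]; ring
    rw [hvol' _ (Nat.cast_nonneg n)]
    push_cast
    have hν0 : (0 : ℝ) < ν := hν
    have e1 : (ν : ℝ) * ((n : ℝ) ^ d * κ) * ((1 + a) / 2 - 1) ≤ ν * (n ^ d * κ) * (-3 / 8) := by
      gcongr; linarith
    have e2 : (ν : ℝ) * (volume (B n)).toReal * (1 + a - 1) ≤ ν * (((n : ℝ) ^ d + 1) / 4 * κ) := by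
      rw [add_sub_cancel_left, mul_assoc]
      gcongr
    have e3 : (ν : ℝ) * κ / 8 * n ≤ ν * κ / 8 * n ^ d := by gcongr
    linarith
  set K : ℝ≥0 := a⁻¹ ^ (i + 1) * 2 ^ j
  calc ∫⁻ ω, ((critConfigs i j (ball 0 1) (X ω)).encard : ℝ≥0∞) ∂μ
      ≤ ∫⁻ ω, ∑' n : ℕ, (K : ℝ≥0∞) * ((((1 + a) / 2 : ℝ≥0) : ℝ≥0∞) ^ (X ω ∩ A n).ncard *
          ((1 + a : ℝ≥0) : ℝ≥0∞) ^ (X ω ∩ B n).ncard) ∂μ :=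
        lintegral_mono fun ω => encard_critConfigs_ball_le i j (h.toLocFin ω) ha
    _ = ∑' n : ℕ, (K : ℝ≥0∞) * ∫⁻ ω, (((1 + a) / 2 : ℝ≥0) : ℝ≥0∞) ^ (X ω ∩ A n).ncard *
          ((1 + a : ℝ≥0) : ℝ≥0∞) ^ (X ω ∩ B n).ncard ∂μ := by
        have hAB : ∀ n, Measurable fun ω => (((1 + a) / 2 : ℝ≥0) : ℝ≥0∞) ^ (X ω ∩ A n).ncard *
            ((1 + a : ℝ≥0) : ℝ≥0∞) ^ (X ω ∩ B n).ncard :=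
          fun n => (hm _ (hA n)).mul (hm _ (hB n))
        rw [lintegral_tsum fun n => ((hAB n).const_mul _).aemeasurable]
        exact tsum_congr fun n => lintegral_const_mul _ (hAB n)
    _ ≤ ∑' n : ℕ, (K : ℝ≥0∞) *
          ENNReal.ofReal (Real.exp (ν * κ / 4) * Real.exp (n * (-(ν * κ / 8)))) :=
        ENNReal.tsum_le_tsum fun n => by gcongr; exact hterm n
    _ < ⊤ := by
        rw [ENNReal.tsum_mul_left]
        refine ENNReal.mul_lt_top ENNReal.coe_lt_top ?_
        have hν0 : (0 : ℝ) < ν := hν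
        have hneg : -((ν : ℝ) * κ / 8) < 0 := by
          have : 0 < (ν : ℝ) * κ / 8 := by positivity
          linarith
        have hs : Summable fun n : ℕ =>
            Real.exp (ν * κ / 4) * Real.exp (n * (-(ν * κ / 8))) :=
          (Real.summable_exp_nat_mul_iff.2 hneg).mul_left _
        exact hs.tsum_ofReal_lt_top

end Poisson

/-- The expected number of critical configurations is finite on compact sets of centers, and
proportional to their volume. -/
lemma exists_lintegral_encard_critConfigs_eq_mul_volume
    {P : Measure (LocFin (EuclideanSpace ℝ (Fin d)))} [IsProbabilityMeasure P] {ν : ℝ≥0}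
    (hP : HasPoissonVoidProb P ν) (i j : ℕ)
    (hfin : ∫⁻ S, ((critConfigs i j (ball 0 1) S.1).encard : ℝ≥0∞) ∂P < ⊤) :
    ∃ c : ℝ≥0, ∀ K : Set (EuclideanSpace ℝ (Fin d)), IsCompact K →
      ∫⁻ S, ((critConfigs i j K S.1).encard : ℝ≥0∞) ∂P = c * volume K := by
  obtain ⟨M, hM⟩ := exists_measure_lintegral_encard_critConfigs i j P
  have hinv : M.IsAddLeftInvariant := by
    refine ⟨fun v => Measure.ext fun B hB => ?_⟩
    have hpre : (fun x => v + x) ⁻¹' B = similarity 1 (-v) '' B := by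
      rw [image_similarity one_pos]
      ext x
      simp [similarity, add_comm]
    have hmeas : Measurable fun x => v + x := measurable_const_add v
    rw [Measure.map_apply hmeas hB, hM _ (hmeas hB), hM _ hB, hpre]
    exact lintegral_encard_critConfigs_similarity hP hP one_pos _ (by simp) i j hB
  have hball : M (ball 0 1) ≠ ⊤ := by
    rw [hM _ measurableSet_ball]
    exact hfin.ne
  have : IsFiniteMeasureOnCompacts M :=
    ⟨fun K hK => measure_lt_top_of_isCompact_of_isAddLeftInvariant (ball 0 1) isOpen_ball
      ⟨0, mem_ball_self one_pos⟩ hball hK⟩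
  refine ⟨Measure.addHaarScalarFactor M volume, fun K hK => ?_⟩
  rw [← hM K hK.measurableSet,
    Measure.measure_isAddInvariant_eq_smul_of_isCompact_closure M volume hK.closure]
  rfl

/-- The expected number of critical configurations with centers in a compact set is linear in
the intensity. -/
lemma exists_lintegral_encard_critConfigs_eq_mul_intensity
    {P : Measure (LocFin (EuclideanSpace ℝ (Fin d)))} [IsProbabilityMeasure P] {ν₀ : ℝ≥0}
    (hν₀ : 0 < ν₀) (hP : HasPoissonVoidProb P ν₀) (hd : 1 ≤ d) (i j : ℕ)
    (hfin : ∫⁻ S, ((critConfigs i j (ball 0 1) S.1).encard : ℝ≥0∞) ∂P < ⊤)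
    {Ω : Set (EuclideanSpace ℝ (Fin d))} (hΩ : IsCompact Ω) :
    ∃ D : ℝ≥0, ∀ (Q : Measure (LocFin (EuclideanSpace ℝ (Fin d)))) [IsProbabilityMeasure Q]
      (ν : ℝ≥0), 0 < ν → HasPoissonVoidProb Q ν →
      ∫⁻ S, ((critConfigs i j Ω S.1).encard : ℝ≥0∞) ∂Q = D * ν := by
  obtain ⟨c, hc⟩ := exists_lintegral_encard_critConfigs_eq_mul_volume hP i j hfin
  refine ⟨c * (volume Ω).toNNReal / ν₀, fun Q _ ν hν hQ => ?_⟩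
  set t : ℝ≥0 := (ν / ν₀) ^ (d⁻¹ : ℝ) with ht_def
  have ht : 0 < t := NNReal.rpow_pos (by positivity)
  have htd : t ^ d = ν / ν₀ := NNReal.rpow_inv_natCast_pow _ (by omega)
  have ht' : (0 : ℝ) < t := ht
  have hscale : (ν : ℝ) = ν₀ * (t : ℝ) ^ d := by
    have : ν = ν₀ * t ^ d := by rw [htd, mul_div_cancel₀ _ hν₀.ne']
    exact_mod_cast this
  have hvol : volume (similarity (t : ℝ) 0 '' Ω) = (ν / ν₀ : ℝ≥0) * volume Ω := by
    rw [image_similarity ht', volume_preimage_similarity (inv_pos.2 ht'), inv_pow, inv_inv, ← htd,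
      ← NNReal.coe_pow, ENNReal.ofReal_coe_nnreal]
  rw [← lintegral_encard_critConfigs_similarity hQ hP ht' 0 hscale i j hΩ.measurableSet,
    hc _ (hΩ.image (continuous_similarity _)), hvol]
  conv_lhs => rw [← ENNReal.coe_toNNReal hΩ.measure_lt_top.ne]
  norm_cast
  field_simp

lemma IsHomPoissonPP.lintegral_encard_critConfigs {Ωs : Type} [MeasurableSpace Ωs]
    {μ : Measure Ωs} {X : Ωs → Set (EuclideanSpace ℝ (Fin d))} {ν : ℝ≥0}
    (h : IsHomPoissonPP μ X ν) (i j : ℕ) {B : Set (EuclideanSpace ℝ (Fin d))}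
    (hB : MeasurableSet B) :
    ∫⁻ S, ((critConfigs i j B S.1).encard : ℝ≥0∞) ∂(μ.map h.toLocFin) =
      ∫⁻ ω, ((critConfigs i j B (X ω)).encard : ℝ≥0∞) ∂μ :=
  lintegral_map (measurable_encard_critConfigs i j hB) h.measurable_toLocFin

/-- When the expected number of critical configurations is finite, it does not matter that
`critConfigCount` assigns the value `0` to infinite families. -/
lemma IsHomPoissonPP.lintegral_critConfigCount {Ωs : Type} [MeasurableSpace Ωs]
    {μ : Measure Ωs} {X : Ωs → Set (EuclideanSpace ℝ (Fin d))} {ν : ℝ≥0}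
    (h : IsHomPoissonPP μ X ν) (i j : ℕ) {B : Set (EuclideanSpace ℝ (Fin d))}
    (hB : MeasurableSet B)
    (hfin : ∫⁻ S, ((critConfigs i j B S.1).encard : ℝ≥0∞) ∂(μ.map h.toLocFin) ≠ ⊤) :
    ∫⁻ ω, (critConfigCount i j B (X ω) : ℝ≥0∞) ∂μ =
      ∫⁻ S, ((critConfigs i j B S.1).encard : ℝ≥0∞) ∂(μ.map h.toLocFin) := by
  rw [h.lintegral_encard_critConfigs i j hB] at hfin ⊢
  have hm : Measurable fun ω => ((critConfigs i j B (X ω)).encard : ℝ≥0∞) :=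
    (measurable_encard_critConfigs i j hB).comp h.measurable_toLocFin
  refine lintegral_congr_ae ?_
  filter_upwards [ae_lt_top hm hfin] with ω hω
  have hf : (critConfigs i j B (X ω)).Finite := by
    rw [← Set.encard_lt_top_iff]
    exact_mod_cast hω
  have : critConfigCount i j B (X ω) = (critConfigs i j B (X ω)).ncard := rfl
  rw [this, ← hf.cast_ncard_eq]
  rfl

/-- For a homogeneous Poisson process of intensity `ν > 0` on `ℝ^d`, the expected number
`E[F_{i,j}]` of critical configurations with centers in a compact set `Ω` equals `D · ν`,
with `D` depending only on `d`, `i`, `j` and `Ω`. -/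
theorem expected_crit_configs_linear (d i j : ℕ) (hi : 1 ≤ i) (hid : i ≤ d)
    (Ω : Set (EuclideanSpace ℝ (Fin d))) (hΩ : IsCompact Ω) :
    ∃ D : ℝ≥0∞, D ≠ ⊤ ∧
      ∀ (Ωs : Type) (_ : MeasurableSpace Ωs) (μ : Measure Ωs)
        (X : Ωs → Set (EuclideanSpace ℝ (Fin d))) (ν : ℝ≥0), 0 < ν →
        IsHomPoissonPP μ X ν →
        ∫⁻ ω, (critConfigCount i j Ω (X ω) : ℝ≥0∞) ∂μ = D * ν := by
  have hd : 1 ≤ d := hi.trans hid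
  by_cases hex : ∃ (Ωs : Type) (_ : MeasurableSpace Ωs) (μ : Measure Ωs)
      (X : Ωs → Set (EuclideanSpace ℝ (Fin d))) (ν : ℝ≥0), 0 < ν ∧ IsHomPoissonPP μ X ν
  · obtain ⟨Ω₀, _, μ₀, X₀, ν₀, hν₀, h₀⟩ := hex
    have := h₀.prob
    have : IsProbabilityMeasure (μ₀.map h₀.toLocFin) :=
      Measure.isProbabilityMeasure_map h₀.measurable_toLocFin.aemeasurable
    have hfin := h₀.lintegral_encard_critConfigs_ball_lt_top hν₀ hd i j
    rw [← h₀.lintegral_encard_critConfigs i j measurableSet_ball] at hfin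
    obtain ⟨D, hD⟩ := exists_lintegral_encard_critConfigs_eq_mul_intensity hν₀
      h₀.hasPoissonVoidProb hd i j hfin hΩ
    refine ⟨D, ENNReal.coe_ne_top, fun Ωs _ μ X ν hν h => ?_⟩
    have := h.prob
    have : IsProbabilityMeasure (μ.map h.toLocFin) :=
      Measure.isProbabilityMeasure_map h.measurable_toLocFin.aemeasurable
    have hE := hD (μ.map h.toLocFin) ν hν h.hasPoissonVoidProb
    rw [h.lintegral_critConfigCount i j hΩ.measurableSet, hE]
    rw [hE]
    exact ENNReal.mul_ne_top ENNReal.coe_ne_top ENNReal.coe_ne_top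
  · refine ⟨0, ENNReal.zero_ne_top, fun Ωs m μ X ν hν h => ?_⟩
    exact absurd ⟨Ωs, m, μ, X, ν, hν, h⟩ hex
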